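/- Let d ≥ 1, let q, s be coprime integers with qs > 1, and let l₁,…,l_r be r parallel lines in ℝ^d. Suppose A is a finite d-dimensional subset of ℝ^d with A ⊆ l₁ ∪ ⋯ ∪ l_r. Then |q·A + s·A| ≥ (|q| + |s| + 2d − 2)|A| − K·r, where K is a constant depending only on q, s, d. -/

import Mathlib

open Pointwise

open Classical in
/-- The sumset `p·A + q·B`. -/
noncomputable def SS {G : Type*} [AddCommGroup G] (p q : ℤ) (A B : Finset G) : Finset G :=
  Finset.image₂ (fun x y => p • x + q • y) A B

section general
set_option linter.unusedSectionVars false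
variable {G : Type*} [AddCommGroup G]

lemma mem_SS {p q : ℤ} {A B : Finset G} {z : G} :
    z ∈ SS p q A B ↔ ∃ x ∈ A, ∃ y ∈ B, p • x + q • y = z := by
  simp [SS, Finset.mem_image₂]

lemma SS_comm (p q : ℤ) (A B : Finset G) : SS p q A B = SS q p B A := by
  ext z
  simp only [mem_SS]
  constructor
  · rintro ⟨x, hx, y, hy, rfl⟩; exact ⟨y, hy, x, hx, add_comm _ _⟩
  · rintro ⟨x, hx, y, hy, rfl⟩; exact ⟨y, hy, x, hx, add_comm _ _⟩

lemma SS_mono {p q : ℤ} {A B A' B' : Finset G} (hA : A ⊆ A') (hB : B ⊆ B') :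
    SS p q A B ⊆ SS p q A' B' := by
  intro z hz
  obtain ⟨x, hx, y, hy, rfl⟩ := mem_SS.1 hz
  exact mem_SS.2 ⟨x, hA hx, y, hB hy, rfl⟩

lemma SS_cd [IsAddTorsionFree G] {p q : ℤ} (hp : p ≠ 0) (hq : q ≠ 0) {A B : Finset G}
    (hA : A.Nonempty) (hB : B.Nonempty) : A.card + B.card ≤ (SS p q A B).card + 1 := by
  classical
  have h1 : SS p q A B = A.image (fun x => p • x) + B.image (fun x => q • x) := by
    ext z
    simp only [mem_SS, Finset.mem_add, Finset.mem_image]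
    constructor
    · rintro ⟨x, hx, y, hy, rfl⟩; exact ⟨_, ⟨x, hx, rfl⟩, _, ⟨y, hy, rfl⟩, rfl⟩
    · rintro ⟨_, ⟨x, hx, rfl⟩, _, ⟨y, hy, rfl⟩, rfl⟩; exact ⟨x, hx, y, hy, rfl⟩
  have := cauchy_davenport_of_isAddTorsionFree (hA.image (fun x => p • x))
    (hB.image (fun x => q • x))
  rw [Finset.card_image_of_injective _ (zsmul_right_injective hp),
    Finset.card_image_of_injective _ (zsmul_right_injective hq), ← h1] at this
  omega

lemma SS_card_left [IsAddTorsionFree G] {p q : ℤ} (hp : p ≠ 0) (hq : q ≠ 0) {A B : Finset G}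
    (hB : B.Nonempty) : A.card ≤ (SS p q A B).card := by
  rcases A.eq_empty_or_nonempty with rfl | hA
  · simp
  · have := SS_cd hp hq hA hB
    have := hB.card_pos
    omega

lemma SS_card_right [IsAddTorsionFree G] {p q : ℤ} (hp : p ≠ 0) (hq : q ≠ 0) {A B : Finset G}
    (hA : A.Nonempty) : B.card ≤ (SS p q A B).card := by
  rw [SS_comm]; exact SS_card_left hq hp hA

lemma sum_card_le {ι : Type*} {I : Finset ι} {T : ι → Finset G} {S : Finset G}
    (hsub : ∀ i ∈ I, T i ⊆ S)
    (hdis : ∀ i ∈ I, ∀ j ∈ I, ∀ z, z ∈ T i → z ∈ T j → i = j) :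
    ∑ i ∈ I, (T i).card ≤ S.card := by
  classical
  rw [← Finset.card_biUnion]
  · exact Finset.card_le_card (Finset.biUnion_subset.2 hsub)
  · intro i hi j hj hij
    exact Finset.disjoint_left.2 fun z h1 h2 => hij (hdis i hi j hj z h1 h2)

end general

/-- `A` meets every residue class mod `n`. -/
def FD (n : ℤ) (A : Finset ℤ) : Prop := ∀ r : ℤ, ∃ x ∈ A, n ∣ x - r

/-- residue class -/
def cl (n : ℤ) (A : Finset ℤ) (i : ℤ) : Finset ℤ := A.filter (fun x => x % n = i)

/-- rescaled residue class -/
def cl' (n : ℤ) (A : Finset ℤ) (i : ℤ) : Finset ℤ := (cl n A i).image (fun x => x / n)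

lemma mem_cl {n : ℤ} {A : Finset ℤ} {i x : ℤ} : x ∈ cl n A i ↔ x ∈ A ∧ x % n = i := by
  simp [cl]

lemma cl_subset {n : ℤ} {A : Finset ℤ} {i : ℤ} : cl n A i ⊆ A := Finset.filter_subset _ _

lemma cl_eq {n : ℤ} {A : Finset ℤ} {i : ℤ} :
    cl n A i = (cl' n A i).image (fun y => n * y + i) := by
  ext x
  simp only [cl', Finset.mem_image]
  constructor
  · intro hx
    refine ⟨x / n, ⟨x, hx, rfl⟩, ?_⟩
    have := Int.mul_ediv_add_emod x n
    rw [(mem_cl.1 hx).2] at this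
    exact this
  · rintro ⟨_, ⟨y, hy, rfl⟩, rfl⟩
    have := Int.mul_ediv_add_emod y n
    rw [(mem_cl.1 hy).2] at this
    rwa [this]

lemma affine_inj {g c : ℤ} (hg : g ≠ 0) : Function.Injective (fun y : ℤ => g * y + c) := by
  intro a b h
  simpa [hg] using h

lemma cl_card {n : ℤ} (hn : n ≠ 0) {A : Finset ℤ} {i : ℤ} :
    (cl n A i).card = (cl' n A i).card := by
  conv_lhs => rw [cl_eq]
  exact Finset.card_image_of_injective _ (affine_inj hn)

lemma SS_affine {g c p q : ℤ} (hg : g ≠ 0) (X : Finset ℤ) :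
    (SS p q (X.image (fun y => g * y + c)) (X.image (fun y => g * y + c))).card
      = (SS p q X X).card := by
  have : SS p q (X.image (fun y => g * y + c)) (X.image (fun y => g * y + c))
      = (SS p q X X).image (fun y => g * y + (p + q) * c) := by
    ext z
    simp only [mem_SS, Finset.mem_image, smul_eq_mul]
    constructor
    · rintro ⟨_, ⟨x, hx, rfl⟩, _, ⟨y, hy, rfl⟩, rfl⟩
      exact ⟨_, ⟨x, hx, y, hy, rfl⟩, by ring⟩
    · rintro ⟨_, ⟨x, hx, y, hy, rfl⟩, rfl⟩
      exact ⟨_, ⟨x, hx, rfl⟩, _, ⟨y, hy, rfl⟩, by ring⟩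
  rw [this, Finset.card_image_of_injective _ (affine_inj hg)]

lemma SS_cl {n p q : ℤ} (hn : n ≠ 0) (A : Finset ℤ) (i : ℤ) :
    (SS p q (cl n A i) (cl n A i)).card = (SS p q (cl' n A i) (cl' n A i)).card := by
  conv_lhs => rw [cl_eq]
  exact SS_affine hn _

lemma sum_cl {n : ℤ} (hn : 0 < n) (A : Finset ℤ) :
    ∑ i ∈ Finset.Ico 0 n, (cl n A i).card = A.card := by
  symm
  apply Finset.card_eq_sum_card_fiberwise (f := fun x => x % n)
  intro x hx
  simp [Int.emod_nonneg x hn.ne', Int.emod_lt_of_pos x hn]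

lemma emod_eq_of_dvd {n x y : ℤ} (h : n ∣ x - y) : x % n = y % n :=
  Int.emod_eq_emod_iff_emod_sub_eq_zero.2 (Int.emod_eq_zero_of_dvd h)

/-- decomposition by residue classes mod q of the first summand -/
lemma sum_SS_cl {p q : ℤ} (hpq : IsCoprime p q) (A : Finset ℤ) (I : Finset ℤ) :
    ∑ i ∈ I, (SS p q (cl q A i) A).card ≤ (SS p q A A).card := by
  apply sum_card_le
  · intro i _; exact SS_mono cl_subset (Finset.Subset.refl _)
  · intro i _ j _ z h1 h2
    obtain ⟨x, hx, y, hy, rfl⟩ := mem_SS.1 h1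
    obtain ⟨x', hx', y', hy', h⟩ := mem_SS.1 h2
    rw [← (mem_cl.1 hx).2, ← (mem_cl.1 hx').2]
    simp only [smul_eq_mul] at h
    have : q ∣ p * (x - x') := ⟨y' - y, by linear_combination -h⟩
    exact emod_eq_of_dvd (hpq.symm.dvd_of_dvd_mul_left this)

lemma FD_base {p q : ℤ} (hp : 0 < p) (hq : 0 < q) (hpq : IsCoprime p q) {A : Finset ℤ}
    (h1 : FD p A) (h2 : FD q A) :
    (p + q) * (A.card : ℤ) ≤ (SS p q A A).card + p * q := by
  have key : ∑ ij ∈ Finset.Ico 0 q ×ˢ Finset.Ico 0 p, (SS p q (cl q A ij.1) (cl p A ij.2)).card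
      ≤ (SS p q A A).card := by
    apply sum_card_le
    · intro i _; exact SS_mono cl_subset cl_subset
    · rintro ⟨i, j⟩ _ ⟨i', j'⟩ _ z h1 h2
      obtain ⟨x, hx, y, hy, rfl⟩ := mem_SS.1 h1
      obtain ⟨x', hx', y', hy', h⟩ := mem_SS.1 h2
      simp only [smul_eq_mul] at h hx hx' hy hy'
      rw [← (mem_cl.1 hx).2, ← (mem_cl.1 hx').2, ← (mem_cl.1 hy).2, ← (mem_cl.1 hy').2]
      have e1 : q ∣ p * (x - x') := ⟨y' - y, by linear_combination -h⟩
      have e2 := hpq.symm.dvd_of_dvd_mul_left e1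
      have e3 : p ∣ q * (y - y') := ⟨x' - x, by linear_combination -h⟩
      have e4 := hpq.dvd_of_dvd_mul_left e3
      rw [emod_eq_of_dvd e2,
        emod_eq_of_dvd e4]
  have ne : ∀ n : ℤ, 0 < n → FD n A → ∀ i ∈ Finset.Ico 0 n, (cl n A i).Nonempty := by
    intro n hn h i hi
    obtain ⟨x, hx, hd⟩ := h i
    refine ⟨x, mem_cl.2 ⟨hx, ?_⟩⟩
    rw [emod_eq_of_dvd hd]
    simp at hi
    exact Int.emod_eq_of_lt hi.1 hi.2
  have key2 : ∑ ij ∈ Finset.Ico 0 q ×ˢ Finset.Ico 0 p, ((cl q A ij.1).card + (cl p A ij.2).card)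
      ≤ ∑ ij ∈ Finset.Ico 0 q ×ˢ Finset.Ico 0 p,
        ((SS p q (cl q A ij.1) (cl p A ij.2)).card + 1) := by
    apply Finset.sum_le_sum
    rintro ⟨i, j⟩ hij
    rw [Finset.mem_product] at hij
    exact SS_cd hp.ne' hq.ne' (ne q hq h2 i hij.1) (ne p hp h1 j hij.2)
  rw [Finset.sum_add_distrib, Finset.sum_add_distrib, Finset.sum_product, Finset.sum_product] at key2
  simp only [Finset.sum_const, smul_eq_mul, ← Finset.mul_sum, sum_cl hp, sum_cl hq, Finset.card_product,
    Int.card_Ico, mul_one, sub_zero] at key2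
  have e1 : (p.toNat : ℤ) = p := Int.toNat_of_nonneg hp.le
  have e2 : (q.toNat : ℤ) = q := Int.toNat_of_nonneg hq.le
  zify at key2 key
  rw [e1, e2] at key2
  linarith

/-- differences of `A` generate `ℤ` -/
def Nrm (A : Finset ℤ) : Prop :=
  ∀ H : AddSubgroup ℤ, (∀ a ∈ A, ∀ b ∈ A, a - b ∈ H) → (1 : ℤ) ∈ H

lemma gain1 {p q : ℤ} (hp : 0 < p) (hq : 0 < q) (hpq : IsCoprime p q) {A : Finset ℤ}
    (hN : Nrm A) {i : ℤ} (hne : (cl q A i).Nonempty) (hfd : ¬ FD q (cl' q A i)) :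
    ∃ j, (cl q A j).Nonempty ∧
      (SS p q (cl q A i) (cl q A i)).card + (cl q A j).card ≤ (SS p q (cl q A i) A).card := by
  classical
  have key : ∃ x ∈ cl q A i, ∃ a ∈ A, ∀ z ∈ SS p q (cl q A i) (cl q A i),
      ¬ q * q ∣ (p * x + q * a) - z := by
    by_contra! hcon
    apply hfd
    have repr : ∀ x ∈ cl q A i, ∃ x' ∈ cl' q A i, x = q * x' + i := by
      intro x hx
      rw [cl_eq] at hx
      obtain ⟨x', h1, h2⟩ := Finset.mem_image.1 hx
      exact ⟨x', h1, h2.symm⟩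
    let S : ℤ → Prop := fun r => ∃ y ∈ cl' q A i, q ∣ r - p * y
    have hstep : ∀ a ∈ A, ∀ r, S r → S (r + (a - i)) := by
      rintro a ha r ⟨y, hy, hd⟩
      have hx : q * y + i ∈ cl q A i := by
        rw [cl_eq]; exact Finset.mem_image_of_mem _ hy
      obtain ⟨z, hz, hdz⟩ := hcon _ hx a ha
      obtain ⟨u, hu, w, hw, rfl⟩ := mem_SS.1 hz
      obtain ⟨u', hu', rfl⟩ := repr u hu
      obtain ⟨w', hw', rfl⟩ := repr w hw
      refine ⟨u', hu', ?_⟩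
      simp only [smul_eq_mul] at hdz
      obtain ⟨k, hk⟩ := hdz
      obtain ⟨l, hl⟩ := hd
      refine ⟨k + l + w', ?_⟩
      apply mul_left_cancel₀ hq.ne'
      linear_combination hk + q * hl
    have hper : ∀ r k, S r → S (r + q * k) := by
      rintro r k ⟨y, hy, l, hl⟩
      exact ⟨y, hy, l + k, by linear_combination hl⟩
    let H0 : AddSubmonoid ℤ :=
      { carrier := {g | ∀ r, S r → S (r + g)}
        zero_mem' := by intro r hr; simpa using hr
        add_mem' := by
          intro a b ha hb r hr
          have := hb _ (ha r hr)
          rwa [add_assoc] at this }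
    let H : AddSubgroup ℤ :=
      { H0 with
        neg_mem' := by
          intro a ha r hr
          have h1 : (q.toNat - 1) • a ∈ H0 := H0.nsmul_mem ha _
          have h2 := hper _ (-a) (h1 r hr)
          have h3 : (((q.toNat - 1 : ℕ) : ℤ)) = q - 1 := by omega
          have : r + (q.toNat - 1) • a + q * -a = r + -a := by
            rw [nsmul_eq_mul, h3]; ring
          rwa [this] at h2 }
    have h1 : (1 : ℤ) ∈ H := by
      apply hN H
      intro a ha b hb
      have e1 : a - i ∈ H := hstep a ha
      have e2 : b - i ∈ H := hstep b hb
      have := H.sub_mem e1 e2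
      simpa using this
    obtain ⟨x, hx⟩ := hne
    obtain ⟨x', hx', -⟩ := repr x hx
    have hall : ∀ r, S r := by
      intro r
      have h2 : (r - p * x') • (1 : ℤ) ∈ H := H.zsmul_mem h1 _
      have h3 : S (p * x') := ⟨x', hx', by simp⟩
      have := h2 _ h3
      simpa using this
    intro r
    obtain ⟨y, hy, hd⟩ := hall (p * r)
    refine ⟨y, hy, ?_⟩
    rw [← mul_sub] at hd
    have := hpq.symm.dvd_of_dvd_mul_left hd
    rwa [dvd_sub_comm]
  obtain ⟨x, hx, a, ha, hz⟩ := key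
  refine ⟨a % q, ⟨a, mem_cl.2 ⟨ha, rfl⟩⟩, ?_⟩
  have e : (SS p q {x} (cl q A (a % q))).card ≥ (cl q A (a % q)).card :=
    SS_card_right hp.ne' hq.ne' (Finset.singleton_nonempty x)
  refine le_trans (Nat.add_le_add_left e _) ?_
  rw [← Finset.card_union_of_disjoint]
  · apply Finset.card_le_card
    apply Finset.union_subset
    · exact SS_mono (Finset.Subset.refl _) cl_subset
    · exact SS_mono (by simpa using hx) cl_subset
  · rw [Finset.disjoint_right]
    intro z hz1 hz2
    apply hz z hz2
    obtain ⟨u, hu, w, hw, rfl⟩ := mem_SS.1 hz1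
    rw [Finset.mem_singleton] at hu
    subst hu
    have h5 : q ∣ a - w := by
      have := (mem_cl.1 hw).2
      exact Int.dvd_of_emod_eq_zero (Int.emod_eq_emod_iff_emod_sub_eq_zero.1 this.symm)
    obtain ⟨k, hk⟩ := h5
    exact ⟨k, by simp only [smul_eq_mul]; linear_combination q * hk⟩

/-- modulus `q` for the class, but `A` is FD mod `p` -/
lemma gain2 {p q : ℤ} (hp : 0 < p) (hq : 0 < q) {A : Finset ℤ} (hpq : IsCoprime p q)
    (hA : FD p A) {i : ℤ} (hfd : ¬ FD p (cl q A i)) :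
    (SS p q (cl q A i) (cl q A i)).card + (cl q A i).card ≤ (SS p q (cl q A i) A).card := by
  classical
  unfold FD at hfd
  push Not at hfd
  obtain ⟨r, hr⟩ := hfd
  obtain ⟨a, ha, hd⟩ := hA r
  have e : (SS p q (cl q A i) {a}).card ≥ (cl q A i).card :=
    SS_card_left hp.ne' hq.ne' (Finset.singleton_nonempty a)
  refine le_trans (Nat.add_le_add_left e _) ?_
  rw [← Finset.card_union_of_disjoint]
  · apply Finset.card_le_card
    apply Finset.union_subset
    · exact SS_mono (Finset.Subset.refl _) cl_subset
    · exact SS_mono (Finset.Subset.refl _) (by simpa using ha)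
  · rw [Finset.disjoint_right]
    intro z hz1 hz2
    obtain ⟨u, hu, w, hw, rfl⟩ := mem_SS.1 hz1
    rw [Finset.mem_singleton] at hw
    subst hw
    obtain ⟨x, hx, y, hy, h⟩ := mem_SS.1 hz2
    simp only [smul_eq_mul] at h
    apply hr y hy
    have : p ∣ q * (y - w) := ⟨u - x, by linear_combination h⟩
    have := hpq.dvd_of_dvd_mul_left this
    have := dvd_add this hd
    simpa using this

lemma FD_cl' {p q : ℤ} (hpq : IsCoprime p q) {A : Finset ℤ} {i : ℤ} (h : FD p (cl q A i)) :
    FD p (cl' q A i) := by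
  intro r
  obtain ⟨x, hx, hd⟩ := h (q * r + i)
  rw [cl_eq] at hx
  obtain ⟨y, hy, rfl⟩ := Finset.mem_image.1 hx
  refine ⟨y, hy, ?_⟩
  refine hpq.dvd_of_dvd_mul_left (?_ : p ∣ q * (y - r))
  have e : q * (y - r) = q * y + i - (q * r + i) := by ring
  rwa [e]

/-- main step -/
lemma stepS {p q : ℤ} (hp : 0 < p) (hq : 0 < q) (hpq : IsCoprime p q) {N k C C' : ℤ}
    (hN : N = p + q + 1) (_hk : 0 ≤ k) (hk2 : k ≤ N * (p + q)) (hC0 : 0 ≤ C') (hCC : C ≤ C')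
    (hT : ∀ X : Finset ℤ, k * X.card ≤ N * (SS p q X X).card + C)
    {A : Finset ℤ} (hA : Nrm A)
    (hF : ∀ i, FD q (cl' q A i) →
      (k + 1) * ((cl q A i).card : ℤ) ≤ N * (SS p q (cl q A i) A).card + C') :
    (k + 1) * (A.card : ℤ) ≤ N * (SS p q A A).card + q * C' := by
  have hNpos : 0 < N := by omega
  have hdec := sum_SS_cl hpq A (Finset.Ico 0 q)
  have hsum := sum_cl hq A
  zify at hdec hsum
  have hmono : ∀ i, ((SS p q (cl q A i) (cl q A i)).card : ℤ) ≤ (SS p q (cl q A i) A).card :=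
    fun i => by exact_mod_cast Finset.card_le_card (SS_mono (Finset.Subset.refl _) cl_subset)
  have hcard : ((Finset.Ico 0 q).card : ℤ) = q := by simp [hq.le]
  by_cases hsmall : ∃ j, (cl q A j).Nonempty ∧ N * ((cl q A j).card : ℤ) < A.card
  · obtain ⟨j, hj, hlt⟩ := hsmall
    have hjm : j ∈ Finset.Ico 0 q := by
      obtain ⟨x, hx⟩ := hj
      rw [← (mem_cl.1 hx).2]
      simp [Int.emod_nonneg x hq.ne', Int.emod_lt_of_pos x hq]
    have h1 : ∀ i ∈ Finset.Ico 0 q, k * ((cl q A i).card : ℤ) +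
        (if i = j then N * (A.card : ℤ) - k * (cl q A j).card else 0)
        ≤ N * ((SS p q (cl q A i) A).card : ℤ) + C' := by
      intro i _
      split_ifs with hij
      · subst hij
        have : (A.card : ℤ) ≤ (SS p q (cl q A i) A).card := by
          exact_mod_cast SS_card_right hp.ne' hq.ne' hj
        nlinarith
      · have := hT (cl q A i)
        have := hmono i
        nlinarith
    have h2 := Finset.sum_le_sum h1
    rw [Finset.sum_add_distrib, Finset.sum_add_distrib, ← Finset.mul_sum, ← Finset.mul_sum,
      hsum, Finset.sum_ite_eq' , if_pos hjm, Finset.sum_const, nsmul_eq_mul, hcard] at h2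
    have h3 := mul_le_mul_of_nonneg_left hdec hNpos.le
    have h4 : k * ((cl q A j).card : ℤ) ≤ (p + q) * A.card := by
      calc k * ((cl q A j).card : ℤ) ≤ N * (p + q) * (cl q A j).card := by gcongr
        _ = (p + q) * (N * (cl q A j).card) := by ring
        _ ≤ (p + q) * A.card := by
          apply mul_le_mul_of_nonneg_left hlt.le; omega
    subst hN
    linarith
  · push Not at hsmall
    have h1 : ∀ i ∈ Finset.Ico 0 q, (k + 1) * ((cl q A i).card : ℤ)
        ≤ N * ((SS p q (cl q A i) A).card : ℤ) + C' := by
      intro i _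
      by_cases hfd : FD q (cl' q A i)
      · exact hF i hfd
      · rcases (cl q A i).eq_empty_or_nonempty with he | hne
        · rw [he]; simp; positivity
        · obtain ⟨j, hj, hg⟩ := gain1 hp hq hpq hA hne hfd
          have e1 := hsmall j hj
          have e2 := hT (cl q A i)
          have e3 : ((cl q A i).card : ℤ) ≤ A.card := by
            exact_mod_cast Finset.card_le_card cl_subset
          zify at hg
          nlinarith
    have h2 := Finset.sum_le_sum h1
    rw [Finset.sum_add_distrib, ← Finset.mul_sum, ← Finset.mul_sum,
      hsum, Finset.sum_const, nsmul_eq_mul, hcard] at h2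
    have h3 := mul_le_mul_of_nonneg_left hdec hNpos.le
    linarith

/-- normalisation -/
lemma exists_nrm {A : Finset ℤ} (hA : 1 < A.card) :
    ∃ (g c : ℤ) (X : Finset ℤ), g ≠ 0 ∧ Nrm X ∧ A = X.image (fun y => g * y + c) := by
  classical
  obtain ⟨a, ha, b, hb, hab⟩ := Finset.one_lt_card.1 hA
  let H := AddSubgroup.closure {z : ℤ | ∃ a ∈ A, ∃ b ∈ A, a - b = z}
  obtain ⟨g, hg⟩ := Int.subgroup_cyclic H
  have hmem : ∀ x ∈ A, ∀ y ∈ A, g ∣ x - y := by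
    intro x hx y hy
    have : x - y ∈ H := AddSubgroup.subset_closure ⟨x, hx, y, hy, rfl⟩
    rw [hg, ← AddSubgroup.zmultiples_eq_closure, Int.mem_zmultiples_iff] at this
    exact this
  have hg0 : g ≠ 0 := by
    rintro rfl
    have := hmem a ha b hb
    rw [zero_dvd_iff] at this
    omega
  refine ⟨g, a, A.image (fun x => (x - a) / g), hg0, ?_, ?_⟩
  · intro K hK
    have hle : H ≤ K.map (AddMonoidHom.mulLeft g) := by
      apply (AddSubgroup.closure_le _).2
      rintro _ ⟨x, hx, y, hy, rfl⟩
      refine ⟨_, hK _ (Finset.mem_image_of_mem _ hx) _ (Finset.mem_image_of_mem _ hy), ?_⟩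
      simp only [AddMonoidHom.coe_mulLeft]
      rw [mul_sub, Int.mul_ediv_cancel' (hmem x hx a ha), Int.mul_ediv_cancel' (hmem y hy a ha)]
      ring
    have hgH : g ∈ H := by rw [hg]; exact AddSubgroup.subset_closure rfl
    obtain ⟨t, ht, he⟩ := hle hgH
    simp only [AddMonoidHom.coe_mulLeft] at he
    have : t = 1 := by
      apply mul_left_cancel₀ hg0; rw [he, mul_one]
    rwa [← this]
  · rw [Finset.image_image]
    ext x
    simp only [Finset.mem_image, Function.comp]
    constructor
    · intro hx
      exact ⟨x, hx, by rw [Int.mul_ediv_cancel' (hmem x hx a ha)]; ring⟩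
    · rintro ⟨y, hy, rfl⟩
      rw [Int.mul_ediv_cancel' (hmem y hy a ha)]
      simpa using hy

lemma FD_affine {n g c : ℤ} {X : Finset ℤ}
    (h : FD n (X.image (fun y => g * y + c))) : FD n X := by
  have hc : IsCoprime n g := by
    obtain ⟨x, hx, k, hk⟩ := h c
    obtain ⟨y, hy, l, hl⟩ := h (c + 1)
    obtain ⟨y', -, rfl⟩ := Finset.mem_image.1 hy
    exact ⟨-l, y', by linear_combination hl⟩
  intro r
  obtain ⟨x, hx, hd⟩ := h (g * r + c)
  obtain ⟨y, hy, rfl⟩ := Finset.mem_image.1 hx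
  refine ⟨y, hy, hc.dvd_of_dvd_mul_left (?_ : n ∣ g * (y - r))⟩
  have e : g * (y - r) = g * y + c - (g * r + c) := by ring
  rwa [e]

theorem oneDim_aux {p q : ℤ} (hp : 0 < p) (hq : 0 < q) (hpq : IsCoprime p q) (n : ℕ)
    (hn : (n : ℤ) ≤ (p + q + 1) * (p + q)) :
    ∃ C : ℤ, 0 ≤ C ∧ ∀ X : Finset ℤ, (n : ℤ) * X.card ≤ (p + q + 1) * (SS p q X X).card + C := by
  induction n with
  | zero => exact ⟨0, le_refl _, fun X => by simp; positivity⟩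
  | succ k ih =>
    push_cast at hn ⊢
    obtain ⟨C, hC0, hC⟩ := ih (by omega)
    have hNpos : 0 < p + q + 1 := by omega
    have small : ∀ A : Finset ℤ, ¬ 1 < A.card → ((k : ℤ) + 1) * A.card ≤ k + 1 := by
      intro A hA
      have : (A.card : ℤ) ≤ 1 := by omega
      nlinarith
    -- sets that are FD mod q
    have hTq : ∃ C1 : ℤ, 0 ≤ C1 ∧ ∀ A : Finset ℤ, FD q A →
        ((k : ℤ) + 1) * A.card ≤ (p + q + 1) * (SS p q A A).card + C1 := by
      let C' := C + (p + q + 1) * (p * q)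
      have hC' : 0 ≤ C' := by positivity
      refine ⟨p * C' + (k + 1), by positivity, ?_⟩
      intro A hA
      by_cases h1 : 1 < A.card
      · obtain ⟨g, c, X, hg, hX, rfl⟩ := exists_nrm h1
        have hXF := FD_affine hA
        rw [SS_affine hg, Finset.card_image_of_injective _ (affine_inj hg), SS_comm]
        have := stepS (A := X) hq hp hpq.symm (N := p + q + 1) (k := k) (C := C) (C' := C')
          (by ring) (by positivity) (by linarith) hC' (le_add_of_nonneg_right (by positivity))
          (fun Y => by rw [SS_comm]; exact hC Y) hX ?_
        · linarith
        · intro i hi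
          by_cases hf : FD q (cl p X i)
          · have e1 := FD_base hq hp hpq.symm (FD_cl' hpq.symm hf) hi
            rw [← SS_cl hp.ne', ← cl_card hp.ne'] at e1
            have e2 : ((SS q p (cl p X i) (cl p X i)).card : ℤ) ≤ (SS q p (cl p X i) X).card := by
              exact_mod_cast Finset.card_le_card (SS_mono (Finset.Subset.refl _) cl_subset)
            have e3 : ((k : ℤ) + 1) * (cl p X i).card ≤
                (p + q + 1) * (p + q) * (cl p X i).card := by gcongr
            have e4 := mul_le_mul_of_nonneg_left (e1.trans (add_le_add_left e2 _)) hNpos.le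
            simp only [C']
            linarith
          · have e1 := gain2 hq hp hpq.symm hXF hf
            have e2 := hC (cl p X i)
            rw [SS_comm] at e2
            zify at e1
            have e4 := mul_le_mul_of_nonneg_left e1 hNpos.le
            have e5 : 0 ≤ (p + q + 1) * (p * q) := by positivity
            have e6 : 0 ≤ (p + q) * ((cl p X i).card : ℤ) := by positivity
            simp only [C']
            linarith
      · have := small A h1
        have : 0 ≤ (p + q + 1) * ((SS p q A A).card : ℤ) := by positivity
        have : 0 ≤ p * C' := by positivity
        linarith
    obtain ⟨C1, hC1, hT1⟩ := hTq
    refine ⟨q * (C + C1) + (k + 1), by positivity, ?_⟩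
    intro A
    by_cases h1 : 1 < A.card
    · obtain ⟨g, c, X, hg, hX, rfl⟩ := exists_nrm h1
      rw [SS_affine hg, Finset.card_image_of_injective _ (affine_inj hg)]
      have := stepS (A := X) hp hq hpq (N := p + q + 1) (k := k) (C := C) (C' := C + C1)
          rfl (by positivity) (by linarith) (by positivity) (le_add_of_nonneg_right hC1)
          hC hX ?_
      · linarith
      · intro i hi
        have e1 := hT1 _ hi
        rw [← SS_cl hq.ne', ← cl_card hq.ne'] at e1
        have e2 : ((SS p q (cl q X i) (cl q X i)).card : ℤ) ≤ (SS p q (cl q X i) X).card := by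
          exact_mod_cast Finset.card_le_card (SS_mono (Finset.Subset.refl _) cl_subset)
        have e4 := mul_le_mul_of_nonneg_left e2 hNpos.le
        linarith
    · have := small A h1
      have : 0 ≤ (p + q + 1) * ((SS p q A A).card : ℤ) := by positivity
      have : 0 ≤ q * (C + C1) := by positivity
      linarith

theorem oneDim {p q : ℤ} (hp : 0 < p) (hq : 0 < q) (hpq : IsCoprime p q) :
    ∃ C : ℤ, 0 ≤ C ∧ ∀ X : Finset ℤ, (p + q) * (X.card : ℤ) ≤ (SS p q X X).card + C := by
  obtain ⟨C, hC, h⟩ := oneDim_aux hp hq hpq ((p + q + 1) * (p + q)).toNat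
    (by rw [Int.toNat_of_nonneg (by positivity)])
  refine ⟨C, hC, fun X => ?_⟩
  have := h X
  rw [Int.toNat_of_nonneg (by positivity)] at this
  have hN : 0 < p + q + 1 := by omega
  by_contra! hc
  nlinarith

theorem oneDim_V {p q : ℤ} {C : ℤ}
    (hC : ∀ X : Finset ℤ, (p + q) * (X.card : ℤ) ≤ (SS p q X X).card + C)
    {V : Type*} [AddCommGroup V] [Module ℚ V] (X : Finset V) :
    (p + q) * (X.card : ℤ) ≤ (SS p q X X).card + C := by
  classical
  obtain ⟨f, hf⟩ := Module.exists_dual_forall_apply_ne_zero (K := ℚ)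
    (ι := {xy : X × X // xy.1 ≠ xy.2}) (fun xy => (xy.1.1 : V) - xy.1.2)
    (fun xy => by
      rw [sub_ne_zero]
      exact fun h => xy.2 (Subtype.ext h))
  have hinj : ∀ x ∈ X, ∀ y ∈ X, f x = f y → x = y := by
    intro x hx y hy h
    by_contra hne
    apply hf ⟨(⟨x, hx⟩, ⟨y, hy⟩), fun h => hne (congrArg Subtype.val h)⟩
    simp [h]
  obtain ⟨⟨N, hN⟩, hint⟩ := IsLocalization.exist_integer_multiples_of_finset
    (nonZeroDivisors ℤ) (X.image f)
  have hN0 : N ≠ 0 := nonZeroDivisors.ne_zero hN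
  have hint' : ∀ x : V, ∃ n : ℤ, x ∈ X → (n : ℚ) = N * f x := by
    intro x
    by_cases hx : x ∈ X
    · obtain ⟨n, hn⟩ := hint (f x) (Finset.mem_image_of_mem _ hx)
      refine ⟨n, fun _ => ?_⟩
      simpa using hn
    · exact ⟨0, fun h => absurd h hx⟩
  choose h hh using hint'
  have hNq : (N : ℚ) ≠ 0 := by exact_mod_cast hN0
  have hcard : (X.image h).card = X.card := by
    apply Finset.card_image_of_injOn
    intro x hx y hy hxy
    have e1 := hh x hx
    have e2 := hh y hy
    rw [hxy, e2] at e1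
    exact hinj x hx y hy (mul_left_cancel₀ hNq e1.symm)
  have hle : (SS p q (X.image h) (X.image h)).card ≤ (SS p q X X).card := by
    rw [← Finset.card_image_of_injective (SS p q (X.image h) (X.image h))
      (Int.cast_injective (α := ℚ))]
    refine le_trans (Finset.card_le_card ?_)
      (Finset.card_image_le (s := SS p q X X) (f := fun z => (N : ℚ) * f z))
    intro z hz
    obtain ⟨w, hw, rfl⟩ := Finset.mem_image.1 hz
    obtain ⟨x', hx', y', hy', rfl⟩ := mem_SS.1 hw
    obtain ⟨x, hx, rfl⟩ := Finset.mem_image.1 hx'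
    obtain ⟨y, hy, rfl⟩ := Finset.mem_image.1 hy'
    refine Finset.mem_image.2 ⟨p • x + q • y, mem_SS.2 ⟨x, hx, y, hy, rfl⟩, ?_⟩
    push_cast
    simp only [smul_eq_mul, map_add, map_zsmul, zsmul_eq_mul, Int.cast_mul, hh x hx, hh y hy]
    ring
  have := hC (X.image h)
  rw [hcard] at this
  have hle' : ((SS p q (X.image h) (X.image h)).card : ℤ) ≤ (SS p q X X).card := by
    exact_mod_cast hle
  linarith

section convex
variable {W : Type*} [NormedAddCommGroup W] [NormedSpace ℝ W] [FiniteDimensional ℝ W]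

lemma exists_ext (D : Finset W) : ∃ P ⊆ D, (∀ x ∈ P, x ∈ (convexHull ℝ (D : Set W)).extremePoints ℝ) ∧
    (D : Set W) ⊆ Submodule.span ℝ (P : Set W) := by
  classical
  have hsub := extremePoints_convexHull_subset (𝕜 := ℝ) (A := (D : Set W))
  refine ⟨D.filter (fun x => x ∈ (convexHull ℝ (D : Set W)).extremePoints ℝ),
    Finset.filter_subset _ _, fun x hx => (Finset.mem_filter.1 hx).2, ?_⟩
  have heq : ((D.filter (fun x => x ∈ (convexHull ℝ (D : Set W)).extremePoints ℝ) : Finset W) : Set W)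
      = (convexHull ℝ (D : Set W)).extremePoints ℝ := by
    ext x
    simp only [Finset.coe_filter, Set.mem_ofPred_eq]
    exact ⟨fun h => h.2, fun h => ⟨hsub h, h⟩⟩
  rw [heq]
  have hfin : ((convexHull ℝ (D : Set W)).extremePoints ℝ).Finite :=
    D.finite_toSet.subset hsub
  have hkm := closure_convexHull_extremePoints (s := convexHull ℝ (D : Set W))
    (D.finite_toSet.isCompact_convexHull ℝ) (convex_convexHull ℝ _)
  rw [(hfin.isClosed_convexHull ℝ).closure_eq] at hkm
  refine (subset_convexHull ℝ (D : Set W)).trans (hkm.symm.subset.trans ?_)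
  exact convexHull_min Submodule.subset_span (Submodule.convex _)

lemma ext_lemma (B : Finset W) {b : W} (hb : b ∈ B) (φ : W →ₗ[ℝ] ℝ)
    (hφ : ∀ x ∈ B, x ≠ b → φ b < φ x) :
    ∃ E ⊆ B, b ∉ E ∧ Module.finrank ℝ (vectorSpan ℝ (B : Set W)) ≤ E.card ∧
      (∀ x ∈ E, ∀ y ∈ B, ∀ z ∈ B, y ≠ b → z ≠ b → ∀ α β : ℝ, 0 < α → 0 < β →
        α • b + β • x ≠ α • y + β • z) ∧
      (∀ x ∈ E, ∀ y ∈ E, ∀ α β : ℝ, 0 < α → 0 < β → α ≠ β →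
        α • b + β • x ≠ α • y + β • b) := by
  classical
  let f : W → ℝ := fun x => φ (x - b)
  let n : W → W := fun x => (f x)⁻¹ • (x - b)
  have hf : ∀ x ∈ B, x ≠ b → 0 < f x := by
    intro x hx hxb
    simp only [f, map_sub]
    linarith [hφ x hx hxb]
  have hn : ∀ x ∈ B, x ≠ b → x - b = f x • n x := by
    intro x hx hxb
    simp only [n]
    rw [smul_smul, mul_inv_cancel₀ (hf x hx hxb).ne', one_smul]
  obtain ⟨P, hPD, hPe, hspan⟩ := exists_ext ((B.erase b).image n)
  have hch : ∀ p : W, ∃ x, p ∈ P → x ∈ B.erase b ∧ n x = p ∧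
      ∀ y ∈ B.erase b, n y = p → f x ≤ f y := by
    intro p
    by_cases hp : p ∈ P
    · have hne : ((B.erase b).filter (fun x => n x = p)).Nonempty := by
        obtain ⟨x, hx, h⟩ := Finset.mem_image.1 (hPD hp)
        exact ⟨x, Finset.mem_filter.2 ⟨hx, h⟩⟩
      obtain ⟨x, hx, hmin⟩ := Finset.exists_min_image _ f hne
      rw [Finset.mem_filter] at hx
      exact ⟨x, fun _ => ⟨hx.1, hx.2, fun y hy h => hmin y (Finset.mem_filter.2 ⟨hy, h⟩)⟩⟩
    · exact ⟨0, fun h => absurd h hp⟩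
  choose g hg using hch
  have hEB : ∀ x ∈ P.image g, x ∈ B.erase b := by
    intro x hx
    obtain ⟨p, hp, rfl⟩ := Finset.mem_image.1 hx
    exact (hg p hp).1
  have hinj : Set.InjOn g P := by
    intro p hp p' hp' h
    rw [← (hg p hp).2.1, ← (hg p' hp').2.1, h]
  refine ⟨P.image g, fun x hx => Finset.mem_of_mem_erase (hEB x hx),
    fun h => Finset.notMem_erase b B (hEB b h), ?_, ?_, ?_⟩
  · rw [Finset.card_image_of_injOn hinj]
    refine le_trans ?_ (finrank_span_finset_le_card (R := ℝ) P)
    apply Submodule.finrank_mono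
    rw [vectorSpan_eq_span_vsub_set_right ℝ (Finset.mem_coe.2 hb), Submodule.span_le]
    rintro _ ⟨x, hx, rfl⟩
    simp only [vsub_eq_sub, SetLike.mem_coe]
    by_cases hxb : x = b
    · subst hxb; simp
    · rw [hn x hx hxb]
      apply Submodule.smul_mem
      apply hspan
      exact Finset.mem_coe.2 (Finset.mem_image_of_mem _ (Finset.mem_erase.2 ⟨hxb, hx⟩))
  · intro x hx y hy z hz hyb hzb α β hα hβ heq
    obtain ⟨p, hp, rfl⟩ := Finset.mem_image.1 hx
    obtain ⟨hxB, hnp, hmin⟩ := hg p hp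
    set x := g p with hxdef
    have hxB' := Finset.mem_erase.1 hxB
    have fx := hf x hxB'.2 hxB'.1
    have fy := hf y hy hyb
    have fz := hf z hz hzb
    have e1 : β • (x - b) = α • (y - b) + β • (z - b) := by
      have : β • x = α • y + β • z - α • b := by rw [← heq]; abel
      rw [smul_sub, this]
      module
    have e2 : β * f x = α * f y + β * f z := by
      have := congrArg φ e1
      simpa only [map_add, map_smul, smul_eq_mul] using this
    have hpos : 0 < β * f x := by positivity
    have hseg : p ∈ openSegment ℝ (n y) (n z) := by
      refine ⟨α * f y / (β * f x), β * f z / (β * f x), by positivity, by positivity, ?_, ?_⟩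
      · rw [← add_div, ← e2, div_self hpos.ne']
      · rw [← hnp]
        rw [hn x hxB'.2 hxB'.1, hn y hy hyb, hn z hz hzb] at e1
        have e3 : n x = (β * f x)⁻¹ • (β • f x • n x) := by
          rw [smul_smul, smul_smul, mul_assoc, inv_mul_cancel₀ hpos.ne', one_smul]
        rw [e3, e1]
        simp only [div_eq_inv_mul, smul_add, smul_smul, mul_assoc]
    have hmemD : ∀ u ∈ B, u ≠ b → n u ∈ convexHull ℝ (((B.erase b).image n : Finset W) : Set W) :=
      fun u hu hub => subset_convexHull ℝ _
        (Finset.mem_coe.2 (Finset.mem_image_of_mem _ (Finset.mem_erase.2 ⟨hub, hu⟩)))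
    have hex := (mem_extremePoints.1 (hPe p hp)).2 _ (hmemD y hy hyb) _ (hmemD z hz hzb) hseg
    have m1 := hmin y (Finset.mem_erase.2 ⟨hyb, hy⟩) hex.1
    have m2 := hmin z (Finset.mem_erase.2 ⟨hzb, hz⟩) hex.2
    have : 0 < α * f y := by positivity
    have : β * f x ≤ β * f z := by gcongr
    linarith
  · intro x hx y hy α β hα hβ hab heq
    obtain ⟨p, hp, rfl⟩ := Finset.mem_image.1 hx
    obtain ⟨p', hp', rfl⟩ := Finset.mem_image.1 hy
    obtain ⟨hxB, hnx, -⟩ := hg p hp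
    obtain ⟨hyB, hny, -⟩ := hg p' hp'
    rw [Finset.mem_erase] at hxB hyB
    have e1 : β • (g p - b) = α • (g p' - b) := by
      have : β • g p = α • g p' + β • b - α • b := by rw [← heq]; abel
      rw [smul_sub, this]
      module
    have e2 : β * f (g p) = α * f (g p') := by
      have := congrArg φ e1
      simpa only [map_smul, smul_eq_mul] using this
    have fx := hf _ hxB.2 hxB.1
    have e3 : p = p' := by
      have k1 := hn _ hxB.2 hxB.1
      have k2 := hn _ hyB.2 hyB.1
      rw [hnx] at k1
      rw [hny] at k2
      rw [k1, k2, smul_smul, smul_smul, e2] at e1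
      have fy := hf _ hyB.2 hyB.1
      exact smul_right_injective W (by positivity : α * f (g p') ≠ 0) e1
    subst e3
    exact hab (mul_right_cancel₀ fx.ne' e2).symm

end convex

section vec
variable {W : Type*} [NormedAddCommGroup W] [NormedSpace ℝ W] [FiniteDimensional ℝ W]
variable {G : Type*} [AddCommGroup G]

open Classical in
/-- fibre -/
noncomputable def fib (π : G →+ W) (A : Finset G) (b : W) : Finset G := A.filter (fun x => π x = b)

open Classical in
/-- complement of a fibre -/
noncomputable def cofib (π : G →+ W) (A : Finset G) (b : W) : Finset G :=
  A.filter (fun x => π x ≠ b)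

set_option linter.unusedSectionVars false in
lemma mem_fib {π : G →+ W} {A : Finset G} {b : W} {x : G} :
    x ∈ fib π A b ↔ x ∈ A ∧ π x = b := by simp [fib]

set_option linter.unusedSectionVars false in
lemma mem_cofib {π : G →+ W} {A : Finset G} {b : W} {x : G} :
    x ∈ cofib π A b ↔ x ∈ A ∧ π x ≠ b := by simp [cofib]

set_option linter.unusedSectionVars false in
open Classical in
lemma split_lemma {p q : ℤ} (hp : 0 < p) (hq : 0 < q) (π : G →+ W) (A : Finset G) (b : W)
    (E : Finset W) (hbE : b ∉ E)
    (h0 : ∀ y ∈ A.image π, ∀ z ∈ A.image π, y ≠ b → z ≠ b → p • b + q • b ≠ p • y + q • z)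
    (h1 : ∀ x ∈ E, ∀ y ∈ A.image π, ∀ z ∈ A.image π, y ≠ b → z ≠ b →
      p • b + q • x ≠ p • y + q • z)
    (h2 : ∀ x ∈ E, ∀ y ∈ A.image π, ∀ z ∈ A.image π, y ≠ b → z ≠ b →
      p • x + q • b ≠ p • y + q • z)
    (h3 : ∀ x ∈ E, ∀ y ∈ E, p • b + q • x ≠ p • y + q • b) :
    (SS p q (cofib π A b) (cofib π A b)).card + (SS p q (fib π A b) (fib π A b)).card
      + ∑ x ∈ E, (SS p q (fib π A b) (fib π A x)).card
      + ∑ x ∈ E, (SS p q (fib π A x) (fib π A b)).card ≤ (SS p q A A).card := by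
  have hpi : ∀ u v : W, ∀ z ∈ SS p q (fib π A u) (fib π A v), π z = p • u + q • v := by
    intro u v z hz
    obtain ⟨x, hx, y, hy, rfl⟩ := mem_SS.1 hz
    rw [← (mem_fib.1 hx).2, ← (mem_fib.1 hy).2]
    simp
  have hco : ∀ z ∈ SS p q (cofib π A b) (cofib π A b), ∃ y ∈ A.image π, ∃ w ∈ A.image π,
      y ≠ b ∧ w ≠ b ∧ π z = p • y + q • w := by
    intro z hz
    obtain ⟨x, hx, y, hy, rfl⟩ := mem_SS.1 hz
    rw [mem_cofib] at hx hy
    exact ⟨_, Finset.mem_image_of_mem _ hx.1, _, Finset.mem_image_of_mem _ hy.1, hx.2, hy.2,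
      by simp⟩
  have hfs : ∀ u : W, fib π A u ⊆ A := fun u => Finset.filter_subset _ _
  have hcs : cofib π A b ⊆ A := Finset.filter_subset _ _
  have cancel : ∀ n : ℤ, 0 < n → ∀ u v : W, n • u = n • v → u = v := by
    intro n hn u v h
    rw [← Int.cast_smul_eq_zsmul ℝ, ← Int.cast_smul_eq_zsmul ℝ] at h
    exact smul_right_injective W (by exact_mod_cast hn.ne' : (n : ℝ) ≠ 0) h
  let T : W ⊕ W → Finset G := Sum.elim (fun x => SS p q (fib π A b) (fib π A x))
    (fun x => SS p q (fib π A x) (fib π A b))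
  have key : ∑ i ∈ (insert b E).disjSum E, (T i).card
      ≤ (SS p q A A \ SS p q (cofib π A b) (cofib π A b)).card := by
    apply sum_card_le
    · rintro (x | x) hx z hz
      · simp only [Finset.inl_mem_disjSum, Finset.mem_insert] at hx
        simp only [T, Sum.elim_inl] at hz
        refine Finset.mem_sdiff.2 ⟨SS_mono (hfs _) (hfs _) hz, fun hz' => ?_⟩
        obtain ⟨y, hy, w, hw, hyb, hwb, he⟩ := hco z hz'
        rw [hpi _ _ z hz] at he
        rcases hx with rfl | hx
        · exact h0 y hy w hw hyb hwb he
        · exact h1 x hx y hy w hw hyb hwb he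
      · simp only [Finset.inr_mem_disjSum] at hx
        simp only [T, Sum.elim_inr] at hz
        refine Finset.mem_sdiff.2 ⟨SS_mono (hfs _) (hfs _) hz, fun hz' => ?_⟩
        obtain ⟨y, hy, w, hw, hyb, hwb, he⟩ := hco z hz'
        rw [hpi _ _ z hz] at he
        exact h2 x hx y hy w hw hyb hwb he
    · have mixed : ∀ x ∈ insert b E, ∀ y ∈ E, p • b + q • x ≠ p • y + q • b := by
        intro x hx y hy h
        rcases Finset.mem_insert.1 hx with rfl | hx
        · have := cancel p hp _ _ (add_right_cancel h)
          exact hbE (this ▸ hy)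
        · exact h3 x hx y hy h
      rintro (x | x) hx (y | y) hy z hz1 hz2 <;>
        simp only [Finset.inl_mem_disjSum, Finset.inr_mem_disjSum] at hx hy <;>
        simp only [T, Sum.elim_inl, Sum.elim_inr] at hz1 hz2 <;>
        have e1 := hpi _ _ z hz1 <;> have e2 := hpi _ _ z hz2 <;> rw [e1] at e2
      · rw [cancel q hq _ _ (add_left_cancel e2)]
      · exact absurd e2 (mixed x hx y hy)
      · exact absurd e2.symm (mixed y hy x hx)
      · rw [cancel p hp _ _ (add_right_cancel e2)]
  rw [Finset.sum_disjSum, Finset.sum_insert hbE] at key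
  simp only [T, Sum.elim_inl, Sum.elim_inr] at key
  have := Finset.card_sdiff_add_card_eq_card (SS_mono (p := p) (q := q) hcs hcs)
  omega

open Classical in
theorem vec [IsAddTorsionFree G] {p q : ℤ} (hp : 0 < p) (hq : 0 < q) (hpq : p ≠ q) {C : ℤ}
    (hC0 : 0 ≤ C) (hC : ∀ X : Finset G, (p + q) * (X.card : ℤ) ≤ (SS p q X X).card + C)
    (π : G →+ W) (A : Finset G) (hA : A.Nonempty) :
    (p + q + 2 * Module.finrank ℝ (vectorSpan ℝ ((A.image π : Finset W) : Set W))) * (A.card : ℤ)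
      ≤ (SS p q A A).card +
        (C + 2 * Module.finrank ℝ (vectorSpan ℝ ((A.image π : Finset W) : Set W))) *
          ((A.image π).card : ℤ) := by
  induction A using Finset.strongInduction with
  | H A ih =>
  set B := A.image π with hB
  -- generic functional
  obtain ⟨φ, hφ⟩ := Module.exists_dual_forall_apply_ne_zero (K := ℝ)
    (ι := {xy : B × B // xy.1 ≠ xy.2}) (fun xy => (xy.1.1 : W) - xy.1.2)
    (fun xy => by
      rw [sub_ne_zero]
      exact fun h => xy.2 (Subtype.ext h))
  obtain ⟨b, hb, hmin⟩ := Finset.exists_min_image B φ (hA.image _)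
  have hφb : ∀ x ∈ B, x ≠ b → φ b < φ x := by
    intro x hx hxb
    refine lt_of_le_of_ne (hmin x hx) fun h => ?_
    apply hφ ⟨(⟨x, hx⟩, ⟨b, hb⟩), fun h => hxb (congrArg Subtype.val h)⟩
    simp [h]
  have hpR : (0 : ℝ) < p := by exact_mod_cast hp
  have hqR : (0 : ℝ) < q := by exact_mod_cast hq
  have hpqR : (p : ℝ) ≠ q := by exact_mod_cast hpq
  have zs : ∀ (n : ℤ) (x : W), n • x = (n : ℝ) • x := fun n x => (Int.cast_smul_eq_zsmul ℝ n x).symm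
  have h0 : ∀ y ∈ A.image π, ∀ z ∈ A.image π, y ≠ b → z ≠ b →
      p • b + q • b ≠ p • y + q • z := by
    intro y hy z hz hyb hzb h
    simp only [zs] at h
    have := congrArg φ h
    simp only [map_add, map_smul, smul_eq_mul] at this
    have := mul_lt_mul_of_pos_left (hφb y hy hyb) hpR
    have := mul_lt_mul_of_pos_left (hφb z hz hzb) hqR
    linarith
  have hfb : (fib π A b).Nonempty := by
    obtain ⟨x, hx, h⟩ := Finset.mem_image.1 hb
    exact ⟨x, mem_fib.2 ⟨hx, h⟩⟩
  have hfx : ∀ x ∈ B, (fib π A x).Nonempty := by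
    intro x hx
    obtain ⟨y, hy, h⟩ := Finset.mem_image.1 hx
    exact ⟨y, mem_fib.2 ⟨hy, h⟩⟩
  have hcard : (fib π A b).card + (cofib π A b).card = A.card :=
    Finset.card_filter_add_card_filter_not _
  have himg : (cofib π A b).image π = B.erase b := by
    ext x
    simp only [Finset.mem_image, mem_cofib, Finset.mem_erase, hB]
    constructor
    · rintro ⟨y, ⟨hy, hyb⟩, rfl⟩; exact ⟨hyb, y, hy, rfl⟩
    · rintro ⟨hxb, y, hy, rfl⟩; exact ⟨y, ⟨hy, hxb⟩, rfl⟩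
  have hBc : ((B.erase b).card : ℤ) + 1 = B.card := by
    exact_mod_cast Finset.card_erase_add_one hb
  have hCb := hC (fib π A b)
  rcases (cofib π A b).eq_empty_or_nonempty with hem | hne
  · -- single fibre
    have hBe : B.erase b = ∅ := by rw [← himg, hem]; simp
    have hB1 : B = {b} := by
      rw [← Finset.insert_erase hb, hBe]; rfl
    have hAe : fib π A b = A := by
      apply Finset.eq_of_subset_of_card_le (Finset.filter_subset _ _)
      rw [hem, Finset.card_empty] at hcard
      change A.card ≤ (fib π A b).card
      omega
    rw [hAe] at hCb
    have hz : Module.finrank ℝ (vectorSpan ℝ (B : Set W)) = 0 := by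
      rw [hB1, Finset.coe_singleton, vectorSpan_singleton]
      exact finrank_bot ℝ W
    have hc1 : B.card = 1 := by rw [hB1]; exact Finset.card_singleton b
    rw [hz, hc1]
    push_cast
    linarith
  have hss : cofib π A b ⊂ A := by
    refine ⟨Finset.filter_subset _ _, fun h => ?_⟩
    obtain ⟨x, hx⟩ := hfb
    rw [mem_fib] at hx
    exact (mem_cofib.1 (h hx.1)).2 hx.2
  have IH := ih _ hss hne
  rw [himg] at IH
  have hins : insert b ((B.erase b : Finset W) : Set W) = (B : Set W) := by
    rw [← Finset.coe_insert, Finset.insert_erase hb]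
  set e := Module.finrank ℝ (vectorSpan ℝ (B : Set W)) with he
  set e' := Module.finrank ℝ (vectorSpan ℝ ((B.erase b : Finset W) : Set W)) with he'
  have hee : e ≤ e' + 1 := by
    rw [he, he', ← hins]
    exact finrank_vectorSpan_insert_le_set ℝ _ _
  have hee' : e' ≤ e := by
    rw [he, he', ← hins]
    exact Submodule.finrank_mono (vectorSpan_mono ℝ (Set.subset_insert _ _))
  zify at hcard
  by_cases hcase : e' = e
  · obtain ⟨E, hEB, hbE, hEc, hE1, hE2⟩ := ext_lemma B hb φ hφb
    have hspl := split_lemma hp hq π A b E hbE h0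
      (fun x hx y hy z hz hyb hzb => by
        simp only [zs]; exact hE1 x hx y hy z hz hyb hzb p q hpR hqR)
      (fun x hx y hy z hz hyb hzb => by
        simp only [zs]
        rw [add_comm, add_comm ((p : ℝ) • y)]
        exact hE1 x hx z hz y hy hzb hyb q p hqR hpR)
      (fun x hx y hy => by
        simp only [zs]; exact hE2 x hx y hy p q hpR hqR hpqR)
    have s1 : E.card * (fib π A b).card ≤ ∑ x ∈ E, (SS p q (fib π A b) (fib π A x)).card := by
      rw [← smul_eq_mul]
      exact Finset.card_nsmul_le_sum _ _ _
        (fun x hx => SS_card_left hp.ne' hq.ne' (hfx x (hEB hx)))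
    have s2 : E.card * (fib π A b).card ≤ ∑ x ∈ E, (SS p q (fib π A x) (fib π A b)).card := by
      rw [← smul_eq_mul]
      exact Finset.card_nsmul_le_sum _ _ _
        (fun x hx => SS_card_right hp.ne' hq.ne' (hfx x (hEB hx)))
    have s3 : e * (fib π A b).card ≤ E.card * (fib π A b).card := Nat.mul_le_mul_right _ hEc
    rw [hcase] at IH
    zify at hspl s1 s2 s3
    rw [← hcard, ← hBc]
    have : (0 : ℤ) ≤ e := by positivity
    linarith
  · have hee2 : e' + 1 = e := by omega
    have hbn : b ∉ affineSpan ℝ ((B.erase b : Finset W) : Set W) := by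
      intro hmem
      apply hcase
      have := affineSpan_insert_eq_affineSpan ℝ hmem
      rw [hins] at this
      rw [he, he', ← direction_affineSpan, ← direction_affineSpan, this]
    have hbn' : ∀ y ∈ B, ∀ x ∈ B, ∀ z ∈ B, y ≠ b → x ≠ b → z ≠ b → ∀ c : ℝ,
        b ≠ c • (x - z) + y := by
      intro y hy x hx z hz hyb hxb hzb c h
      apply hbn
      have my : y ∈ affineSpan ℝ ((B.erase b : Finset W) : Set W) :=
        subset_affineSpan ℝ _ (Finset.mem_coe.2 (Finset.mem_erase.2 ⟨hyb, hy⟩))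
      have mx : x ∈ affineSpan ℝ ((B.erase b : Finset W) : Set W) :=
        subset_affineSpan ℝ _ (Finset.mem_coe.2 (Finset.mem_erase.2 ⟨hxb, hx⟩))
      have mz : z ∈ affineSpan ℝ ((B.erase b : Finset W) : Set W) :=
        subset_affineSpan ℝ _ (Finset.mem_coe.2 (Finset.mem_erase.2 ⟨hzb, hz⟩))
      have hm := AffineSubspace.smul_vsub_vadd_mem _ c mx mz my
      rwa [show c • (x -ᵥ z) +ᵥ y = b from h.symm] at hm
    have hone : ∀ α β : ℝ, 0 < α → ∀ x ∈ B.erase b, ∀ y ∈ B, ∀ z ∈ B, y ≠ b → z ≠ b →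
        α • b + β • x ≠ α • y + β • z := by
      intro α β hα x hx y hy z hz hyb hzb h
      rw [Finset.mem_erase] at hx
      apply hbn' y hy z hz x hx.2 hyb hzb hx.1 (β / α)
      apply smul_right_injective W hα.ne'
      have e1 : α • b = α • y + β • z - β • x := by rw [← h]; abel
      simp only
      rw [e1, smul_add, smul_smul, mul_div_cancel₀ _ hα.ne']
      module
    have hspl := split_lemma hp hq π A b (B.erase b) (Finset.notMem_erase b B) h0
      (fun x hx y hy z hz hyb hzb => by
        simp only [zs]; exact hone p q hpR x hx y hy z hz hyb hzb)
      (fun x hx y hy z hz hyb hzb => by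
        simp only [zs]
        rw [add_comm, add_comm ((p : ℝ) • y)]
        exact hone q p hqR x hx z hz y hy hzb hyb)
      (fun x hx y hy => by
        simp only [zs]
        intro h
        rw [Finset.mem_erase] at hx hy
        have hd : (p : ℝ) - q ≠ 0 := sub_ne_zero.2 hpqR
        apply hbn' y hy.2 y hy.2 x hx.2 hy.1 hy.1 hx.1 (q / (p - q))
        apply smul_right_injective W hd
        simp only
        rw [smul_add, smul_smul, mul_div_cancel₀ _ hd]
        have e1 : (p : ℝ) • b = (p : ℝ) • y + (q : ℝ) • b - (q : ℝ) • x := by rw [← h]; abel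
        rw [sub_smul, e1]
        module)
    have hsumf : ∑ x ∈ B.erase b, (fib π A x).card = (cofib π A b).card := by
      symm
      rw [Finset.card_eq_sum_card_fiberwise (f := π) (t := B.erase b)]
      · apply Finset.sum_congr rfl
        intro x hx
        congr 1
        ext y
        simp only [Finset.mem_filter, mem_cofib, mem_fib]
        rw [Finset.mem_erase] at hx
        constructor
        · rintro ⟨⟨h1, -⟩, h2⟩; exact ⟨h1, h2⟩
        · rintro ⟨h1, h2⟩; exact ⟨⟨h1, h2 ▸ hx.1⟩, h2⟩
      · intro x hx
        rw [← himg]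
        exact Finset.mem_coe.2 (Finset.mem_image_of_mem _ hx)
    have s1 : ∑ x ∈ B.erase b, ((fib π A b).card + (fib π A x).card)
        ≤ ∑ x ∈ B.erase b, ((SS p q (fib π A b) (fib π A x)).card + 1) :=
      Finset.sum_le_sum fun x hx => SS_cd hp.ne' hq.ne' hfb (hfx x (Finset.mem_of_mem_erase hx))
    have s2 : ∑ x ∈ B.erase b, ((fib π A x).card + (fib π A b).card)
        ≤ ∑ x ∈ B.erase b, ((SS p q (fib π A x) (fib π A b)).card + 1) :=
      Finset.sum_le_sum fun x hx => SS_cd hp.ne' hq.ne' (hfx x (Finset.mem_of_mem_erase hx)) hfb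
    rw [Finset.sum_add_distrib, Finset.sum_add_distrib, hsumf, Finset.sum_const, Finset.sum_const,
      smul_eq_mul, smul_eq_mul, mul_one] at s1 s2
    have hBe : e ≤ (B.erase b).card := by
      have hpos : 0 < (B.erase b).card := by
        rw [← himg]; exact (hne.image _).card_pos
      obtain ⟨n, hn⟩ : ∃ n, (B.erase b).card = n + 1 := ⟨_, (Nat.succ_pred_eq_of_pos hpos).symm⟩
      have := finrank_vectorSpan_image_finset_le ℝ (id : W → W) (B.erase b) hn
      rw [Finset.image_id] at this
      omega
    have s3 : e * (fib π A b).card ≤ (B.erase b).card * (fib π A b).card :=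
      Nat.mul_le_mul_right _ hBe
    have hee3 : (e' : ℤ) = e - 1 := by omega
    rw [hee3] at IH
    zify at hspl s1 s2 s3
    rw [← hcard, ← hBc]
    have : (0 : ℤ) ≤ e := by positivity
    linarith

theorem vec_dec [IsAddTorsionFree G] [DecidableEq W] {p q : ℤ} (hp : 0 < p) (hq : 0 < q)
    (hpq : p ≠ q) {C : ℤ}
    (hC0 : 0 ≤ C) (hC : ∀ X : Finset G, (p + q) * (X.card : ℤ) ≤ (SS p q X X).card + C)
    (π : G →+ W) (A : Finset G) (hA : A.Nonempty) :
    (p + q + 2 * Module.finrank ℝ (vectorSpan ℝ ((A.image π : Finset W) : Set W))) * (A.card : ℤ)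
      ≤ (SS p q A A).card +
        (C + 2 * Module.finrank ℝ (vectorSpan ℝ ((A.image π : Finset W) : Set W))) *
          ((A.image π).card : ℤ) := by
  convert vec hp hq hpq hC0 hC π A hA

end vec

theorem main_pos (d : ℕ) (q s : ℤ) (hq : 0 < q) (hs : 0 < s) (hco : IsCoprime q s)
    (hqs : 1 < q * s) :
    ∃ K : ℤ, ∀ (r : ℕ) (v : Fin d → ℝ), v ≠ 0 →
      ∀ (a : Fin r → (Fin d → ℝ)) (A : Finset (Fin d → ℝ)),
        (∀ x ∈ A, ∃ (i : Fin r) (t : ℝ), x = a i + t • v) →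
        affineSpan ℝ (A : Set (Fin d → ℝ)) = ⊤ →
        (q + s + 2 * d - 2) * (A.card : ℤ) ≤ (SS q s A A).card + K * r := by
  classical
  obtain ⟨C, hC0, hC⟩ := oneDim hq hs hco
  have hne : q ≠ s := by
    rintro rfl
    rw [isCoprime_self, Int.isUnit_iff] at hco
    rcases hco with rfl | rfl <;> omega
  refine ⟨C + 2 * d, ?_⟩
  intro r v hv a A hcov hspan
  have hA : A.Nonempty := by
    rw [← Finset.coe_nonempty, ← affineSpan_nonempty ℝ, hspan]
    exact ⟨0, AffineSubspace.mem_top _ _ _⟩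
  obtain ⟨i, hi⟩ := Function.ne_iff.1 hv
  let π : (Fin d → ℝ) →ₗ[ℝ] (Fin d → ℝ) :=
    LinearMap.id - (LinearMap.toSpanSingleton ℝ _ v).comp ((v i)⁻¹ • LinearMap.proj i)
  have hπ : ∀ x, π x = x - ((v i)⁻¹ * x i) • v := by
    intro x; simp [π, LinearMap.toSpanSingleton_apply]
  have hπv : π v = 0 := by
    rw [hπ, inv_mul_cancel₀ hi, one_smul, sub_self]
  have hker : LinearMap.ker π ≤ Submodule.span ℝ {v} := by
    intro x hx
    rw [LinearMap.mem_ker, hπ, sub_eq_zero] at hx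
    rw [hx]
    exact Submodule.smul_mem _ _ (Submodule.mem_span_singleton_self v)
  have hkr : Module.finrank ℝ (LinearMap.ker π) ≤ 1 :=
    (Submodule.finrank_mono hker).trans (finrank_span_singleton hv).le
  have hrn := LinearMap.finrank_range_add_finrank_ker π
  rw [Module.finrank_fin_fun] at hrn
  have hvs : vectorSpan ℝ ((A.image π.toAddMonoidHom : Finset (Fin d → ℝ)) : Set (Fin d → ℝ))
      = LinearMap.range π := by
    have h1 : vectorSpan ℝ (A : Set (Fin d → ℝ)) = ⊤ := by
      rw [← direction_affineSpan, hspan, AffineSubspace.direction_top]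
    rw [Finset.coe_image, LinearMap.range_eq_map, ← h1]
    exact (AffineMap.map_vectorSpan (f := π.toAffineMap)).symm
  have hBr : (A.image π.toAddMonoidHom).card ≤ r := by
    have : A.image π.toAddMonoidHom ⊆ Finset.univ.image (fun j => π (a j)) := by
      intro y hy
      obtain ⟨x, hx, rfl⟩ := Finset.mem_image.1 hy
      obtain ⟨j, t, rfl⟩ := hcov x hx
      refine Finset.mem_image.2 ⟨j, Finset.mem_univ _, ?_⟩
      simp [hπv]
    refine (Finset.card_le_card this).trans (Finset.card_image_le.trans ?_)
    simp
  have key : (q + s + 2 * Module.finrank ℝ (vectorSpan ℝ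
        ((A.image π.toAddMonoidHom : Finset (Fin d → ℝ)) : Set (Fin d → ℝ)))) * (A.card : ℤ)
      ≤ (SS q s A A).card +
        (C + 2 * Module.finrank ℝ (vectorSpan ℝ
          ((A.image π.toAddMonoidHom : Finset (Fin d → ℝ)) : Set (Fin d → ℝ)))) *
          ((A.image π.toAddMonoidHom).card : ℤ) := by
    exact vec_dec hq hs hne hC0 (fun X => oneDim_V hC X) π.toAddMonoidHom A hA
  rw [hvs] at key
  set e := Module.finrank ℝ (LinearMap.range π) with he
  have e1 : (d : ℤ) - 1 ≤ e := by omega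
  have e2 : (e : ℤ) ≤ d := by omega
  zify at hBr
  have f1 : (q + s + 2 * d - 2) * (A.card : ℤ) ≤ (q + s + 2 * e) * (A.card : ℤ) := by
    apply mul_le_mul_of_nonneg_right _ (by positivity); linarith
  have f2 : (C + 2 * e) * ((A.image π.toAddMonoidHom).card : ℤ) ≤ (C + 2 * d) * r := by
    apply mul_le_mul _ hBr (by positivity) (by positivity); linarith
  linarith

theorem stmt7 (d : ℕ) (hd : 1 ≤ d) (q s : ℤ) (hco : IsCoprime q s) (hqs : 1 < q * s) :
    ∃ K : ℝ, ∀ (r : ℕ) (v : Fin d → ℝ), v ≠ 0 →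
      ∀ (a : Fin r → (Fin d → ℝ)) (A : Finset (Fin d → ℝ)),
        (∀ x ∈ A, ∃ (i : Fin r) (t : ℝ), x = a i + t • v) →
        affineSpan ℝ (A : Set (Fin d → ℝ)) = ⊤ →
        ((|q| : ℝ) + (|s| : ℝ) + 2 * d - 2) * A.card - K * r ≤
          (((A.image fun x => (q : ℝ) • x) + (A.image fun x => (s : ℝ) • x)).card : ℝ) := by
  have hsign : (0 < q ∧ 0 < s) ∨ (q < 0 ∧ s < 0) :=
    mul_pos_iff.1 (by linarith : 0 < q * s)
  have hq0 : q ≠ 0 := by rintro rfl; simp at hqs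
  have hs0 : s ≠ 0 := by rintro rfl; simp at hqs
  have habs : |q| * |s| = q * s := by
    rw [← abs_mul, abs_of_pos (by linarith)]
  obtain ⟨K, hK⟩ := main_pos d |q| |s| (abs_pos.2 hq0) (abs_pos.2 hs0)
    hco.abs_abs (by rw [habs]; exact hqs)
  refine ⟨K, ?_⟩
  intro r v hv a A hcov hspan
  have h := hK r v hv a A hcov hspan
  have hcard : (SS |q| |s| A A).card
      = ((A.image fun x => (q : ℝ) • x) + (A.image fun x => (s : ℝ) • x)).card := by
    have heq : SS q s A A = (A.image fun x => (q : ℝ) • x) + (A.image fun x => (s : ℝ) • x) := by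
      ext z
      simp only [mem_SS, Finset.mem_add, Finset.mem_image, ← Int.cast_smul_eq_zsmul ℝ]
      constructor
      · rintro ⟨x, hx, y, hy, rfl⟩; exact ⟨_, ⟨x, hx, rfl⟩, _, ⟨y, hy, rfl⟩, rfl⟩
      · rintro ⟨_, ⟨x, hx, rfl⟩, _, ⟨y, hy, rfl⟩, rfl⟩; exact ⟨x, hx, y, hy, rfl⟩
    rw [← heq]
    rcases hsign with ⟨h1, h2⟩ | ⟨h1, h2⟩
    · rw [abs_of_pos h1, abs_of_pos h2]
    · rw [abs_of_neg h1, abs_of_neg h2]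
      rw [← Finset.card_image_of_injective (SS q s A A) neg_injective]
      congr 1
      ext z
      simp only [mem_SS, Finset.mem_image]
      constructor
      · rintro ⟨x, hx, y, hy, rfl⟩
        exact ⟨_, ⟨x, hx, y, hy, rfl⟩, by simp only [neg_smul]; abel⟩
      · rintro ⟨_, ⟨x, hx, y, hy, rfl⟩, rfl⟩
        exact ⟨x, hx, y, hy, by simp only [neg_smul]; abel⟩
  rw [← hcard]
  have h' : (((|q| + |s| + 2 * d - 2) * (A.card : ℤ) : ℤ) : ℝ)
      ≤ (((SS |q| |s| A A).card + K * r : ℤ) : ℝ) := by exact_mod_cast h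
  push_cast at h'
  linarith
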